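/- The fifth basic cohomology of the Schrödinger-Virasoro conformal algebra with trivial coefficients is two-dimensional: H̃⁵(SV,ℂ) = ℂΛ ⊕ ℂΨ, where Λ is the 5-cochain with Λ_{λ₁,…,λ₅}(L,L,Y,Y,M) = (λ₁−λ₂)(λ₃−λ₄)λ₅ and zero on all other tuples of generators, and Ψ is the 5-cochain with Ψ_{λ₁,…,λ₅}(L,Y,Y,M,M) = (λ₂−λ₃)(λ₄−λ₅) and zero on all other tuples of generators. In particular, Λ and Ψ are 5-cocycles, neither is a 5-coboundary, and their classes form a basis of H̃⁵(SV,ℂ). -/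

import Mathlib

/-!
Cochain complex of the Schrödinger–Virasoro conformal algebra
`SV = ℂ[∂]L ⊕ ℂ[∂]Y ⊕ ℂ[∂]M` with coefficients in the trivial module `ℂ_a`.

Since `SV` is a free `ℂ[∂]`-module on the generators `L, Y, M`, and since a
`q`-cochain (a `ℂ`-linear, conformally antilinear map `SV^{⊗q} → ℂ[λ₁,…,λ_q]`)
is uniquely determined by its values on `q`-tuples of generators, we model
cochains as functions from generator tuples to `ℂ[λ₁,…,λ_q]`, subject to the
skew-symmetry condition (simultaneous permutation of the entries and the
variables `λᵢ`).
-/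

namespace SVCA

open MvPolynomial

/-- The generators `L`, `Y`, `M` of the Schrödinger–Virasoro conformal algebra. -/
inductive SVGen : Type
  | L | Y | M
  deriving DecidableEq

open SVGen

/-- The λ-brackets on generators: `SVbrk a b = (x, c₁, c₂)` encodes
`[a_λ b] = (c₁ ∂ + c₂ λ) x`.  Zero brackets are encoded by zero coefficients:
`[L_λ L] = (∂+2λ)L`, `[L_λ Y] = (∂+(3/2)λ)Y`, `[Y_λ L] = ((1/2)∂+(3/2)λ)Y`,
`[Y_λ Y] = (∂+2λ)M`, `[L_λ M] = (∂+λ)M`, `[M_λ L] = λM`, and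
`[Y_λ M] = [M_λ Y] = [M_λ M] = 0`. -/
noncomputable def SVbrk : SVGen → SVGen → SVGen × ℂ × ℂ
  | L, L => (L, 1, 2)
  | L, Y => (Y, 1, 3/2)
  | Y, L => (Y, 1/2, 3/2)
  | Y, Y => (M, 1, 2)
  | L, M => (M, 1, 1)
  | M, L => (M, 0, 1)
  | _, _ => (M, 0, 0)

/-- The space of (not necessarily skew-symmetric) `q`-cochains with trivial
coefficients: functions from `q`-tuples of generators to `ℂ[λ₁,…,λ_q]`. -/
abbrev SVRaw (q : ℕ) := (Fin q → SVGen) → MvPolynomial (Fin q) ℂ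

/-- The `ℂ`-subspace `C̃^q(SV,ℂ)` of `q`-cochains: skew-symmetry with respect to
simultaneous permutations of the arguments and of the variables `λᵢ`. -/
noncomputable def SVCochain (q : ℕ) : Submodule ℂ (SVRaw q) where
  carrier := {c | ∀ (σ : Equiv.Perm (Fin q)) (a : Fin q → SVGen),
      rename σ (c (a ∘ σ)) = ((Equiv.Perm.sign σ : ℤ) : ℂ) • c a}
  add_mem' := by
    intro c c' hc hc' σ a
    simp only [Pi.add_apply, map_add, hc σ a, hc' σ a, smul_add]
  zero_mem' := by intro σ a; simp
  smul_mem' := by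
    intro r c hc σ a
    simp only [Pi.smul_apply, map_smul, hc σ a]
    rw [smul_comm]

/-- The strictly increasing embedding `Fin q → Fin (q+2)` omitting `i` and `j`
(meaningful for `i < j`; junk otherwise). -/
def SVskip {q : ℕ} (i j : Fin (q + 2)) (k : Fin q) : Fin (q + 2) :=
  j.succAbove ((⟨min (i : ℕ) q, Nat.lt_succ_of_le (Nat.min_le_right _ _)⟩ : Fin (q + 1)).succAbove k)

/-- The `(i,j)`-summand of the differential (trivial coefficients):
`(-1)^{i+j} γ_{λᵢ+λⱼ, λ₁, …, λ̂ᵢ, …, λ̂ⱼ, …}([a_{i λᵢ} a_j], a₁, …, âᵢ, …, âⱼ, …)`,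
where `[a_{i λᵢ} a_j] = (c₁∂ + c₂λᵢ)x` and conformal antilinearity in the first
slot (whose variable is `λᵢ+λⱼ`) produces the factor `c₂λᵢ - c₁(λᵢ+λⱼ)`. -/
noncomputable def SVdTerm {q : ℕ} (c : SVRaw (q + 1)) (a : Fin (q + 2) → SVGen)
    (i j : Fin (q + 2)) : MvPolynomial (Fin (q + 2)) ℂ :=
  ((-1 : ℂ) ^ ((i : ℕ) + (j : ℕ))) •
    ((C (SVbrk (a i) (a j)).2.2 * X i - C (SVbrk (a i) (a j)).2.1 * (X i + X j)) *
      aeval (Fin.cons (X i + X j) fun k => X (SVskip i j k))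
        (c (Fin.cons (SVbrk (a i) (a j)).1 fun k => a (SVskip i j k))))

/-- The differential `d_q : C̃^q → C̃^{q+1}` (trivial coefficients). -/
noncomputable def SVd : {q : ℕ} → SVRaw q → SVRaw (q + 1)
  | 0, _ => 0
  | (q + 1), c => fun a =>
      ∑ i : Fin (q + 2), ∑ j : Fin (q + 2),
        if (i : ℕ) < (j : ℕ) then SVdTerm c a i j else 0

lemma SVdTerm_add {q : ℕ} (c c' : SVRaw (q + 1)) (a : Fin (q + 2) → SVGen)
    (i j : Fin (q + 2)) :
    SVdTerm (c + c') a i j = SVdTerm c a i j + SVdTerm c' a i j := by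
  simp [SVdTerm, mul_add, smul_add]

lemma SVdTerm_smul {q : ℕ} (r : ℂ) (c : SVRaw (q + 1)) (a : Fin (q + 2) → SVGen)
    (i j : Fin (q + 2)) :
    SVdTerm (r • c) a i j = r • SVdTerm c a i j := by
  simp only [SVdTerm, Pi.smul_apply, map_smul, mul_smul_comm]
  rw [smul_comm]

/-- The differential as a `ℂ`-linear map. -/
noncomputable def SVdLin (q : ℕ) : SVRaw q →ₗ[ℂ] SVRaw (q + 1) where
  toFun := SVd
  map_add' c c' := by
    cases q with
    | zero => simp [SVd]
    | succ q =>
      funext a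
      simp only [SVd, Pi.add_apply]
      rw [← Finset.sum_add_distrib]
      refine Finset.sum_congr rfl fun i _ => ?_
      rw [← Finset.sum_add_distrib]
      refine Finset.sum_congr rfl fun j _ => ?_
      by_cases h : (i : ℕ) < (j : ℕ)
      · simp [h, SVdTerm_add]
      · simp [h]
  map_smul' r c := by
    cases q with
    | zero => simp [SVd]
    | succ q =>
      funext a
      simp only [SVd, RingHom.id_apply, Pi.smul_apply, Finset.smul_sum]
      refine Finset.sum_congr rfl fun i _ => ?_
      refine Finset.sum_congr rfl fun j _ => ?_
      by_cases h : (i : ℕ) < (j : ℕ)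
      · simp [h, SVdTerm_smul]
      · simp [h]

/-- The space `D̃^q(SV,ℂ)` of `q`-cocycles: skew-symmetric cochains with `dγ = 0`. -/
noncomputable def SVcocycles (q : ℕ) : Submodule ℂ (SVRaw q) :=
  SVCochain q ⊓ LinearMap.ker (SVdLin q)

/-- The space `B̃^q(SV,ℂ)` of `q`-coboundaries: differentials of `(q-1)`-cochains
(`0` for `q = 0`). -/
noncomputable def SVcoboundaries : (q : ℕ) → Submodule ℂ (SVRaw q)
  | 0 => ⊥
  | (q + 1) => Submodule.map (SVdLin q) (SVCochain q)

/-- The basic cohomology `H̃^q(SV,ℂ)` = cocycles / coboundaries. -/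
noncomputable def SVbasicH (q : ℕ) :=
  SVcocycles q ⧸ Submodule.comap (SVcocycles q).subtype (SVcoboundaries q)


noncomputable instance (q : ℕ) : AddCommGroup (SVbasicH q) := by
  unfold SVbasicH; infer_instance
noncomputable instance (q : ℕ) : Module ℂ (SVbasicH q) := by
  unfold SVbasicH; infer_instance

/-- The action of `∂` on `q`-cochains with coefficients in `ℂ_a`:
`(∂γ)_{λ₁,…,λ_q} = (a + λ₁ + ⋯ + λ_q)·γ_{λ₁,…,λ_q}`.  (The trivial module `ℂ`
is the case `a = 0`.) -/
noncomputable def SVpartial (a : ℂ) (q : ℕ) : SVRaw q →ₗ[ℂ] SVRaw q where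
  toFun c := fun t => (C a + ∑ i, X i) * c t
  map_add' c c' := by funext t; simp [mul_add]
  map_smul' r c := by funext t; simp [mul_smul_comm]

/-- The subspace `∂C̃^q ⊆ C̃^q` (with coefficients in `ℂ_a`). -/
noncomputable def SVpartialSub (a : ℂ) (q : ℕ) : Submodule ℂ (SVRaw q) :=
  Submodule.map (SVpartial a q) (SVCochain q)

/-- `q`-cochains representing reduced `q`-cocycles: cochains `γ` with
`dγ ∈ ∂C̃^{q+1}` (these are exactly the representatives of `ker d̄`
in the quotient complex `C̃^•/∂C̃^•`). -/
noncomputable def SVredCocycles (a : ℂ) (q : ℕ) : Submodule ℂ (SVRaw q) :=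
  SVCochain q ⊓ Submodule.comap (SVdLin q) (SVpartialSub a (q + 1))

/-- `q`-cochains representing reduced `q`-coboundaries: `∂C̃^q + dC̃^{q-1}`
(these are exactly the representatives of `im d̄` in the quotient complex). -/
noncomputable def SVredCoboundaries (a : ℂ) : (q : ℕ) → Submodule ℂ (SVRaw q)
  | 0 => SVpartialSub a 0
  | (q + 1) => SVpartialSub a (q + 1) ⊔ Submodule.map (SVdLin q) (SVCochain q)

/-- The reduced cohomology `H^q(SV,ℂ_a)`, realized (via the third isomorphism
theorem) as `{γ ∈ C̃^q : dγ ∈ ∂C̃^{q+1}} / (∂C̃^q + dC̃^{q-1})`. -/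
noncomputable def SVredH (a : ℂ) (q : ℕ) :=
  SVredCocycles a q ⧸ Submodule.comap (SVredCocycles a q).subtype (SVredCoboundaries a q)


noncomputable instance (a : ℂ) (q : ℕ) : AddCommGroup (SVredH a q) := by
  unfold SVredH; infer_instance
noncomputable instance (a : ℂ) (q : ℕ) : Module ℂ (SVredH a q) := by
  unfold SVredH; infer_instance

/-- The cocycles of the subcomplex `∂C̃^•` (trivial coefficients `ℂ`). -/
noncomputable def SVsubCocycles (q : ℕ) : Submodule ℂ (SVRaw q) :=
  SVpartialSub 0 q ⊓ LinearMap.ker (SVdLin q)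

/-- The coboundaries of the subcomplex `∂C̃^•` (trivial coefficients `ℂ`). -/
noncomputable def SVsubCoboundaries : (q : ℕ) → Submodule ℂ (SVRaw q)
  | 0 => ⊥
  | (q + 1) => Submodule.map (SVdLin q) (SVpartialSub 0 q)

/-- The cohomology `H^q(∂C̃^•)` of the subcomplex `∂C̃^•` (trivial coefficients). -/
noncomputable def SVsubH (q : ℕ) :=
  SVsubCocycles q ⧸ Submodule.comap (SVsubCocycles q).subtype (SVsubCoboundaries q)


noncomputable instance (q : ℕ) : AddCommGroup (SVsubH q) := by
  unfold SVsubH; infer_instance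
noncomputable instance (q : ℕ) : Module ℂ (SVsubH q) := by
  unfold SVsubH; infer_instance

/-- The operator `τ`:
`(τγ)_{λ₁,…,λ_{q-1}}(a₁,…,a_{q-1}) = (-1)^{q-1} ∂/∂λ γ_{λ₁,…,λ_{q-1},λ}(a₁,…,a_{q-1},L)|_{λ=0}`. -/
noncomputable def SVtau {q : ℕ} (c : SVRaw (q + 1)) : SVRaw q := fun a =>
  ((-1 : ℂ) ^ q) •
    aeval (Fin.snoc (fun i : Fin q => X i) 0)
      (pderiv (Fin.last q) (c (Fin.snoc a SVGen.L)))

/-- The operator `τ₂`: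
`(τ₂γ)_{λ₁,…,λ_{q-1}}(a₁,…,a_{q-1}) = (-1)^{q-1} γ_{λ₁,…,λ_{q-1},λ}(a₁,…,a_{q-1},L)|_{λ=0}`. -/
noncomputable def SVtau2 {q : ℕ} (c : SVRaw (q + 1)) : SVRaw q := fun a =>
  ((-1 : ℂ) ^ q) • aeval (Fin.snoc (fun i : Fin q => X i) 0) (c (Fin.snoc a SVGen.L))

/-- The tuple with `k` copies of `L`, then `l` copies of `Y`, then copies of `M`. -/
def SVtuple (q k l : ℕ) : Fin q → SVGen := fun i =>
  if (i : ℕ) < k then SVGen.L else if (i : ℕ) < k + l then SVGen.Y else SVGen.M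

/-- `∏_{i<j ∈ s} (λᵢ - λⱼ)`. -/
noncomputable def SVvandermonde (q : ℕ) (s : Finset (Fin q)) : MvPolynomial (Fin q) ℂ :=
  ∏ p ∈ (s ×ˢ s).filter fun p => p.1 < p.2, (X p.1 - X p.2)

/-- `(g, n)` stands for the basis element `g_(n)` of the annihilation Lie algebra of `SV`. -/
abbrev SVBasis := SVGen × ℕ

instance : Fintype SVGen := ⟨{L, Y, M}, fun x => by cases x <;> decide⟩

/-- The coefficients of a cochain, as a function of tuples of basis elements. -/
noncomputable def SVcoeff {q : ℕ} (c : SVRaw q) (u : Fin q → SVBasis) : ℂ :=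
  coeff (Finsupp.equivFunOnFinite.symm fun i => (u i).2) (c fun i => (u i).1)

/-- Alternating functions of tuples. -/
def IsAlt {q : ℕ} {α : Type*} (F : (Fin q → α) → ℂ) : Prop :=
  ∀ (σ : Equiv.Perm (Fin q)) (u : Fin q → α), F (u ∘ σ) = ((Equiv.Perm.sign σ : ℤ) : ℂ) * F u

lemma SVcoeff_mk {q : ℕ} (c : SVRaw q) (a : Fin q → SVGen) (s : Fin q →₀ ℕ) :
    SVcoeff c (fun i => (a i, s i)) = coeff s (c a) := by
  simp only [SVcoeff, Finsupp.equivFunOnFinite_symm_coe]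

lemma SVRaw_ext {q : ℕ} {c c' : SVRaw q} (h : ∀ u, SVcoeff c u = SVcoeff c' u) : c = c' := by
  funext a
  ext s
  rw [← SVcoeff_mk, h, SVcoeff_mk]

lemma mem_SVCochain_iff {q : ℕ} (c : SVRaw q) : c ∈ SVCochain q ↔ IsAlt (SVcoeff c) := by
  have key (σ : Equiv.Perm (Fin q)) (u : Fin q → SVBasis) :
      coeff (Finsupp.equivFunOnFinite.symm fun i => (u i).2)
        (rename σ (c ((fun i => (u i).1) ∘ σ))) = SVcoeff c (u ∘ σ) := by
    have : (Finsupp.equivFunOnFinite.symm fun i => (u i).2) =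
        (Finsupp.equivFunOnFinite.symm fun i => ((u ∘ σ) i).2).mapDomain σ := by
      ext i
      obtain ⟨j, rfl⟩ := σ.surjective i
      rw [Finsupp.mapDomain_apply σ.injective]
      simp
    rw [this, coeff_rename_mapDomain _ σ.injective]
    rfl
  constructor
  · intro h σ u
    rw [← key, h σ, coeff_smul]
    rfl
  · intro h σ a
    ext s
    have := h σ fun i => (a i, s i)
    rw [← key, SVcoeff_mk] at this
    simpa only [Finsupp.equivFunOnFinite_symm_coe, coeff_smul, smul_eq_mul] using this

lemma exists_SVcoeff_eq {q : ℕ} (F : (Fin q → SVBasis) → ℂ) (B : ℕ)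
    (hF : ∀ u, F u ≠ 0 → ∀ i, (u i).2 ≤ B) : ∃ c : SVRaw q, SVcoeff c = F := by
  classical
  refine ⟨fun a => ∑ s ∈ Fintype.piFinset fun _ : Fin q => Finset.range (B + 1),
    monomial (Finsupp.equivFunOnFinite.symm s) (F fun i => (a i, s i)), ?_⟩
  funext u
  simp only [SVcoeff, coeff_sum, coeff_monomial, EmbeddingLike.apply_eq_iff_eq]
  rw [Finset.sum_ite_eq']
  split_ifs with h
  · rfl
  · by_contra hne
    refine h ?_
    simpa [Nat.lt_succ_iff] using hF u (Ne.symm hne)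

lemma SVcoeff_bounded {q : ℕ} (c : SVRaw q) :
    ∃ B : ℕ, ∀ u, SVcoeff c u ≠ 0 → ∀ i, (u i).2 ≤ B := by
  classical
  refine ⟨Finset.univ.sup fun a => (c a).totalDegree, fun u hu i => ?_⟩
  calc (u i).2 ≤ ∑ i, (u i).2 :=
        Finset.single_le_sum (f := fun i => (u i).2) (fun _ _ => Nat.zero_le _) (Finset.mem_univ i)
    _ ≤ (c fun i => (u i).1).totalDegree := by
        have := le_totalDegree (mem_support_iff.mpr hu)
        rwa [Finsupp.sum_fintype _ _ fun _ => rfl] at this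
    _ ≤ _ := Finset.le_sup (f := fun a => (c a).totalDegree) (Finset.mem_univ _)

/-- The bracket of two basis elements is a multiple of `SVbasisBrk`. -/
def SVbasisBrk : SVBasis → SVBasis → SVBasis
  | (L, m), (L, n) => (L, m + n - 1)
  | (L, m), (Y, n) => (Y, m + n - 1)
  | (Y, m), (L, n) => (Y, m + n - 1)
  | (_, m), (_, n) => (M, m + n - 1)

/-- Twice the coefficients `c₁`, `c₂` of `SVbrk`. -/
def SVbrkTwo : SVGen → SVGen → ℤ × ℤ
  | L, L => (2, 4)
  | L, Y => (2, 3)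
  | Y, L => (1, 3)
  | Y, Y => (2, 4)
  | L, M => (2, 2)
  | M, L => (0, 2)
  | _, _ => (0, 0)

/-- Twice the structure constants with respect to the (not normalized) basis. -/
def SVstr (b c : SVBasis) : ℤ :=
  if b.2 + c.2 = 0 then 0 else
    ((SVbrkTwo b.1 c.1).2 - (SVbrkTwo b.1 c.1).1) *
      (if b.2 = 0 then 0 else ((b.2 + c.2 - 1).choose (b.2 - 1) : ℤ)) -
    (SVbrkTwo b.1 c.1).1 * ((b.2 + c.2 - 1).choose b.2 : ℤ)

lemma SVbasisBrk_fst (b c : SVBasis) : (SVbasisBrk b c).1 = (SVbrk b.1 c.1).1 := by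
  obtain ⟨b, m⟩ := b
  obtain ⟨c, n⟩ := c
  cases b <;> cases c <;> rfl

lemma SVbasisBrk_snd (b c : SVBasis) : (SVbasisBrk b c).2 = b.2 + c.2 - 1 := by
  obtain ⟨b, m⟩ := b
  obtain ⟨c, n⟩ := c
  cases b <;> cases c <;> rfl

lemma SVbrkTwo_fst (b c : SVGen) : ((SVbrkTwo b c).1 : ℂ) = 2 * (SVbrk b c).2.1 := by
  cases b <;> cases c <;> norm_num [SVbrkTwo, SVbrk]

lemma SVbrkTwo_snd (b c : SVGen) : ((SVbrkTwo b c).2 : ℂ) = 2 * (SVbrk b c).2.2 := by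
  cases b <;> cases c <;> norm_num [SVbrkTwo, SVbrk]

lemma SVbasisBrk_comm (b c : SVBasis) : SVbasisBrk b c = SVbasisBrk c b := by
  obtain ⟨b, m⟩ := b
  obtain ⟨c, n⟩ := c
  cases b <;> cases c <;> simp [SVbasisBrk, add_comm]

lemma SVstr_comm (b c : SVBasis) : SVstr b c = -SVstr c b := by
  obtain ⟨b, m⟩ := b
  obtain ⟨c, n⟩ := c
  rcases m with _ | m <;> rcases n with _ | n
  · simp [SVstr]
  · cases b <;> cases c <;> simp [SVstr, SVbrkTwo]
  · cases b <;> cases c <;> simp [SVstr, SVbrkTwo]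
  · have h1 : (m + 1 + (n + 1) - 1).choose (n + 1) = (m + 1 + (n + 1) - 1).choose (m + 1 - 1) :=
      Nat.choose_symm_of_eq_add (by omega)
    have h2 : (m + 1 + (n + 1) - 1).choose (n + 1 - 1) = (m + 1 + (n + 1) - 1).choose (m + 1) :=
      Nat.choose_symm_of_eq_add (by omega)
    have h3 : n + 1 + (m + 1) - 1 = m + 1 + (n + 1) - 1 := by omega
    unfold SVstr
    rw [if_neg (by simp), if_neg (by simp), if_neg (by simp), if_neg (by simp), h3, h1, h2]
    cases b <;> cases c <;> simp only [SVbrkTwo] <;> ring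

/-- Twice the conformal weight. -/
def SVwt : SVBasis → ℤ
  | (L, n) => 2 * n - 2
  | (Y, n) => 2 * n - 1
  | (M, n) => 2 * n

lemma SVwt_brk {b c : SVBasis} (h : SVstr b c ≠ 0) :
    SVwt (SVbasisBrk b c) = SVwt b + SVwt c := by
  obtain ⟨b, m⟩ := b
  obtain ⟨c, n⟩ := c
  have h0 : m + n ≠ 0 := fun h0 => h (by simp [SVstr, h0])
  cases b <;> cases c <;> simp only [SVwt, SVbasisBrk] <;>
    first
    | omega
    | exact absurd (by simp [SVstr, SVbrkTwo]) h

/-- The Chevalley–Eilenberg differential in coordinates, multiplied by two. -/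
def CEd {R : Type*} [CommRing R] {q : ℕ} (F : (Fin (q + 1) → SVBasis) → R)
    (u : Fin (q + 2) → SVBasis) : R :=
  ∑ i : Fin (q + 2), ∑ j : Fin (q + 2), if (i : ℕ) < (j : ℕ) then
    (-1) ^ ((i : ℕ) + (j : ℕ)) * (SVstr (u i) (u j) *
      F (Fin.cons (SVbasisBrk (u i) (u j)) fun k => u (SVskip i j k))) else 0

lemma IsAlt.eq_zero {q : ℕ} {α : Type*} {F : (Fin q → α) → ℂ} (hF : IsAlt F) {u : Fin q → α}
    {i j : Fin q} (hij : i ≠ j) (h : u i = u j) : F u = 0 := by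
  have h1 := hF (Equiv.swap i j) u
  have h2 : u ∘ Equiv.swap i j = u := by
    funext k
    simp only [Function.comp_apply, Equiv.swap_apply_def]
    split_ifs with hi hj
    · rw [hi, h]
    · rw [hj, h]
    · rfl
  rw [h2, Equiv.Perm.sign_swap hij] at h1
  push_cast at h1
  linear_combination h1 / 2

lemma IsAlt.cons {q : ℕ} {α : Type*} {F : (Fin (q + 1) → α) → ℂ} (hF : IsAlt F) (x : α) :
    IsAlt fun u : Fin q → α => F (Fin.cons x u) := by
  intro σ u
  have h := hF (Equiv.Perm.decomposeFin.symm (0, σ)) (Fin.cons x u)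
  rw [Equiv.Perm.decomposeFin.symm_sign] at h
  simp only [if_true, one_mul] at h
  rw [← h]
  change F (Fin.cons x (u ∘ σ)) = _
  congr 1
  funext k
  refine Fin.cases ?_ (fun k => ?_) k <;> simp

/-- Alternatization over the choice of the first entry. -/
noncomputable def altSum {q : ℕ} {α : Type*} (f : α → (Fin q → α) → ℂ)
    (v : Fin (q + 1) → α) : ℂ :=
  ∑ i : Fin (q + 1), (-1) ^ (i : ℕ) * f (v i) fun k => v (i.succAbove k)

lemma isAlt_altSum {q : ℕ} {α : Type*} {f : α → (Fin q → α) → ℂ} (hf : ∀ x, IsAlt (f x)) :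
    IsAlt (altSum f) := by
  let Φ : (Fin (q + 1) → α) → ℂ := fun w => f (w 0) fun k => w k.succ
  have hΦ (ρ : Equiv.Perm (Fin (q + 1))) (hρ : ρ 0 = 0) (w : Fin (q + 1) → α) :
      Φ (w ∘ ρ) = ((Equiv.Perm.sign ρ : ℤ) : ℂ) * Φ w := by
    obtain ⟨⟨p, e⟩, rfl⟩ := Equiv.Perm.decomposeFin.symm.surjective ρ
    obtain rfl : p = 0 := by simpa using hρ
    rw [Equiv.Perm.decomposeFin.symm_sign]
    simp only [if_true, one_mul]
    rw [← hf]
    simp [Φ, Function.comp_def]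
  have hterm (v : Fin (q + 1) → α) (i : Fin (q + 1)) :
      (-1) ^ (i : ℕ) * f (v i) (fun k => v (i.succAbove k)) =
        ((Equiv.Perm.sign i.cycleRange : ℤ) : ℂ) * Φ (v ∘ i.cycleRange.symm) := by
    rw [Fin.sign_cycleRange]
    simp [Φ]
  intro σ v
  unfold altSum
  rw [Finset.mul_sum]
  conv_rhs => rw [← Equiv.sum_comp σ]
  refine Finset.sum_congr rfl fun i _ => ?_
  rw [hterm, hterm]
  let ρ : Equiv.Perm (Fin (q + 1)) := (σ i).cycleRange * σ * i.cycleRange⁻¹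
  have hρ : ρ 0 = 0 := by
    change (σ i).cycleRange (σ (i.cycleRange.symm 0)) = 0
    rw [Fin.cycleRange_symm_zero, Fin.cycleRange_self]
  have h := hΦ ρ hρ (v ∘ (σ i).cycleRange.symm)
  have hcomp : (v ∘ (σ i).cycleRange.symm) ∘ ρ = (v ∘ σ) ∘ i.cycleRange.symm := by
    funext k
    change v ((σ i).cycleRange.symm ((σ i).cycleRange (σ (i.cycleRange.symm k)))) = _
    rw [Equiv.symm_apply_apply]
    rfl
  rw [hcomp] at h
  rw [h]
  simp only [ρ, Equiv.Perm.sign_mul, Equiv.Perm.sign_inv]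
  have h1 (e : ℤˣ) : ((e : ℤ) : ℂ) * ((e : ℤ) : ℂ) = 1 := by
    rw [← Int.cast_mul, ← Units.val_mul, Int.units_mul_self]; simp
  push_cast
  linear_combination (((Equiv.Perm.sign (σ i).cycleRange : ℤ) : ℂ) * (Equiv.Perm.sign σ : ℤ) *
    Φ (v ∘ (σ i).cycleRange.symm)) * h1 (Equiv.Perm.sign i.cycleRange)

lemma SVskip_of_lt {q : ℕ} {i j : Fin (q + 2)} (h : i < j) (k : Fin q) :
    SVskip i j k = i.succAbove ((⟨j - 1, by omega⟩ : Fin (q + 1)).succAbove k) := by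
  ext
  simp only [SVskip, Fin.succAbove, Fin.lt_def, Fin.val_castSucc]
  rw [Fin.lt_def] at h
  split_ifs <;> simp only [Fin.val_castSucc, Fin.val_succ] at * <;> omega

lemma SVskip_of_lt_left {q : ℕ} {i j : Fin (q + 2)} (h : i < j) (k : Fin q) :
    SVskip i j k = j.succAbove ((⟨i, by omega⟩ : Fin (q + 1)).succAbove k) := by
  ext
  simp only [SVskip, Fin.succAbove, Fin.lt_def, Fin.val_castSucc]
  rw [Fin.lt_def] at h
  split_ifs <;> simp only [Fin.val_castSucc, Fin.val_succ] at * <;> omega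

lemma two_mul_CEd {q : ℕ} (F : (Fin (q + 1) → SVBasis) → ℂ) (u : Fin (q + 2) → SVBasis) :
    2 * CEd F u = -altSum (fun x => altSum fun y w => (SVstr x y : ℂ) *
      F (Fin.cons (SVbasisBrk x y) w)) u := by
  let D : Fin (q + 2) → Fin (q + 2) → ℂ := fun i j => (-1) ^ ((i : ℕ) + (j : ℕ)) *
    (SVstr (u i) (u j) * F (Fin.cons (SVbasisBrk (u i) (u j)) fun k => u (SVskip i j k)))
  have h1 : CEd F u = ∑ i, ∑ j, if i < j then D i j else 0 := rfl
  have h2 : CEd F u = ∑ i, ∑ j, if j < i then D j i else 0 := by rw [h1, Finset.sum_comm]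
  rw [two_mul]
  nth_rewrite 2 [h2]
  rw [h1, ← Finset.sum_add_distrib]
  unfold altSum
  rw [← Finset.sum_neg_distrib]
  refine Finset.sum_congr rfl fun i _ => ?_
  rw [← Finset.sum_add_distrib, Fin.sum_univ_succAbove _ i, Finset.mul_sum,
    ← Finset.sum_neg_distrib]
  simp only [lt_irrefl, if_false, add_zero, zero_add]
  refine Finset.sum_congr rfl fun j _ => ?_
  rcases lt_or_ge j.castSucc i with h | h
  · have hj : i.succAbove j = j.castSucc := Fin.succAbove_of_castSucc_lt _ _ h
    have hs : (fun k => u (SVskip j.castSucc i k)) = fun k => u (i.succAbove (j.succAbove k)) := by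
      funext k
      rw [SVskip_of_lt_left h]
      rfl
    rw [hj, if_neg (not_lt_of_gt h), if_pos h]
    simp only [D, hs]
    rw [SVbasisBrk_comm (u i), SVstr_comm (u i), pow_add]
    push_cast
    simp only [Fin.val_castSucc]
    ring
  · have h' : i < j.succ := Fin.le_castSucc_iff.mp h
    have hj : i.succAbove j = j.succ := Fin.succAbove_of_le_castSucc _ _ h
    have hs : (fun k => u (SVskip i j.succ k)) = fun k => u (i.succAbove (j.succAbove k)) := by
      funext k
      rw [SVskip_of_lt h']
      rfl
    rw [hj, if_pos h', if_neg (not_lt_of_gt h')]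
    simp only [D, hs, Fin.val_succ, pow_add]
    ring

lemma IsAlt.CEd {q : ℕ} {F : (Fin (q + 1) → SVBasis) → ℂ} (hF : IsAlt F) : IsAlt (CEd F) := by
  have h : IsAlt (altSum fun x => altSum fun y w => (SVstr x y : ℂ) *
      F (Fin.cons (SVbasisBrk x y) w)) := by
    refine isAlt_altSum fun x => isAlt_altSum fun y σ w => ?_
    rw [mul_left_comm]
    exact congrArg _ (hF.cons _ σ w)
  intro σ u
  linear_combination two_mul_CEd F (u ∘ σ) / 2 -
    ((Equiv.Perm.sign σ : ℤ) : ℂ) * two_mul_CEd F u / 2 - h σ u / 2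

lemma IsAlt.cons_succAbove {q : ℕ} {α : Type*} {F : (Fin (q + 1) → α) → ℂ} (hF : IsAlt F)
    (u : Fin (q + 1) → α) (i : Fin (q + 1)) :
    F (Fin.cons (u i) fun k => u (i.succAbove k)) = (-1) ^ (i : ℕ) * F u := by
  have h := hF i.cycleRange.symm u
  rw [Equiv.Perm.sign_symm, Fin.sign_cycleRange] at h
  push_cast at h
  rw [← h]
  congr 1
  funext k
  refine Fin.cases ?_ (fun k => ?_) k <;> simp

lemma SVskip_injective {q : ℕ} (i j : Fin (q + 2)) : Function.Injective (SVskip i j) :=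
  Fin.succAbove_right_injective.comp Fin.succAbove_right_injective

lemma eq_or_eq_or_exists_SVskip {q : ℕ} {i j : Fin (q + 2)} (h : i < j) (l : Fin (q + 2)) :
    l = i ∨ l = j ∨ ∃ k, SVskip i j k = l := by
  rcases Fin.eq_self_or_eq_succAbove i l with rfl | ⟨l, rfl⟩
  · exact Or.inl rfl
  rcases Fin.eq_self_or_eq_succAbove (⟨j - 1, by omega⟩ : Fin (q + 1)) l with rfl | ⟨l, rfl⟩
  · refine Or.inr (Or.inl ?_)
    ext
    rw [Fin.lt_def] at h
    simp only [Fin.succAbove, Fin.lt_def, Fin.val_castSucc]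
    split_ifs <;> simp only [Fin.val_castSucc, Fin.val_succ] <;> omega
  · exact Or.inr (Or.inr ⟨l, SVskip_of_lt h l⟩)

lemma SVskip_ne_left {q : ℕ} {i j : Fin (q + 2)} (h : i < j) (k : Fin q) : SVskip i j k ≠ i := by
  rw [SVskip_of_lt h]
  exact Fin.succAbove_ne _ _

lemma SVskip_ne_right {q : ℕ} (i j : Fin (q + 2)) (k : Fin q) : SVskip i j k ≠ j :=
  Fin.succAbove_ne _ _

lemma coeff_add_pow_mul_prod {q : ℕ} {i j : Fin (q + 2)} (h : i < j) (N : ℕ) (t : Fin q → ℕ)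
    (s : Fin (q + 2) →₀ ℕ) :
    coeff s ((X i + X j : MvPolynomial (Fin (q + 2)) ℂ) ^ N * ∏ k, X (SVskip i j k) ^ t k) =
      if s i + s j = N ∧ (fun k => s (SVskip i j k)) = t then (N.choose (s i) : ℂ) else 0 := by
  let G : ℕ → ℕ → (Fin (q + 2) →₀ ℕ) := fun x y =>
    Finsupp.single i x + Finsupp.single j y + ∑ k, Finsupp.single (SVskip i j k) (t k)
  have hGi (x y : ℕ) : G x y i = x := by
    simp [G, h.ne', SVskip_ne_left h]
  have hGj (x y : ℕ) : G x y j = y := by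
    simp [G, h.ne, SVskip_ne_right]
  have hGk (x y : ℕ) (k : Fin q) : G x y (SVskip i j k) = t k := by
    simp [G, Finsupp.single_apply, (SVskip_ne_left h k).symm,
      (SVskip_ne_right i j k).symm, (SVskip_injective i j).eq_iff]
  have hG (x y : ℕ) : G x y = s ↔ s i = x ∧ s j = y ∧ (fun k => s (SVskip i j k)) = t := by
    constructor
    · intro hs
      subst hs
      exact ⟨hGi x y, hGj x y, funext (hGk x y)⟩
    · rintro ⟨h1, h2, h3⟩
      ext l
      rcases eq_or_eq_or_exists_SVskip h l with rfl | rfl | ⟨k, rfl⟩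
      · rw [hGi, h1]
      · rw [hGj, h2]
      · rw [hGk, ← h3]
  have hmon (x y : ℕ) : (X i ^ x * X j ^ y * ∏ k, X (SVskip i j k) ^ t k :
      MvPolynomial (Fin (q + 2)) ℂ) = monomial (G x y) 1 := by
    simp only [G, X_pow_eq_monomial, monomial_mul, one_mul, ← monomial_sum_one]
  have hsum : (X i + X j : MvPolynomial (Fin (q + 2)) ℂ) ^ N * ∏ k, X (SVskip i j k) ^ t k =
      ∑ x ∈ Finset.range (N + 1), monomial (G x (N - x)) (N.choose x : ℂ) := by
    rw [add_pow, Finset.sum_mul]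
    refine Finset.sum_congr rfl fun x _ => ?_
    rw [mul_right_comm, hmon, ← map_natCast (C : ℂ →+* MvPolynomial (Fin (q + 2)) ℂ), mul_comm,
      C_mul_monomial, mul_one]
  rw [hsum, coeff_sum]
  simp only [coeff_monomial, hG]
  split_ifs with hs
  · rw [Finset.sum_eq_single (s i)]
    · rw [if_pos ⟨rfl, by omega, hs.2⟩]
    · intro x _ hx
      rw [if_neg fun hh => hx hh.1.symm]
    · intro hx
      exact absurd (Finset.mem_range.mpr (by omega)) hx
  · refine Finset.sum_eq_zero fun x hx => if_neg fun hh => hs ⟨?_, hh.2.2⟩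
    rw [Finset.mem_range] at hx
    omega

lemma choose_linear_aux (x y N : ℕ) (r A B : ℂ) :
    r * A * (if x ≠ 0 then if x - 1 + y = N then (N.choose (x - 1) : ℂ) else 0 else 0) +
      r * B * (if y ≠ 0 then if x + (y - 1) = N then (N.choose x : ℂ) else 0 else 0) =
    (if x + y = 0 then 0 else
      A * (if x = 0 then 0 else ((x + y - 1).choose (x - 1) : ℂ)) +
      B * ((x + y - 1).choose x : ℂ)) * if x + y - 1 = N then r else 0 := by
  by_cases hN : x + y - 1 = N
  · subst hN
    rcases x with _ | x
    · rcases y with _ | y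
      · simp
      · simp [mul_comm]
    · have e1 : x + 1 + y - 1 = x + y := by omega
      rcases y with _ | y
      · simp [mul_comm]
      · have e2 : x + 1 + y = x + (y + 1) := by omega
        simp [e1, e2]
        ring
  · rcases x with _ | x
    · rcases y with _ | y
      · simp
      · rw [if_neg hN]
        simp only [zero_add, add_tsub_cancel_right] at hN
        simp [hN]
    · have e1 : x + 1 + y - 1 = x + y := by omega
      rw [e1] at hN
      rcases y with _ | y
      · simp_all
      · have e2 : x + 1 + y = x + (y + 1) := by omega
        simp [e1, e2, hN]

lemma coeff_linear_mul_aeval {q : ℕ} {i j : Fin (q + 2)} (h : i < j) (A B : ℂ)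
    (p : MvPolynomial (Fin (q + 1)) ℂ) (s : Fin (q + 2) → ℕ) :
    coeff (Finsupp.equivFunOnFinite.symm s) ((C A * X i + C B * X j) *
      aeval (Fin.cons (X i + X j) fun k => X (SVskip i j k) :
        Fin (q + 1) → MvPolynomial (Fin (q + 2)) ℂ) p) =
      (if s i + s j = 0 then 0 else
        A * (if s i = 0 then 0 else ((s i + s j - 1).choose (s i - 1) : ℂ)) +
        B * ((s i + s j - 1).choose (s i) : ℂ)) *
      coeff (Finsupp.equivFunOnFinite.symm
        (Fin.cons (s i + s j - 1) fun k => s (SVskip i j k))) p := by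
  classical
  obtain ⟨s, rfl⟩ := Finsupp.equivFunOnFinite.surjective s
  rw [Equiv.symm_apply_apply]
  simp only [Finsupp.equivFunOnFinite_apply]
  induction p using MvPolynomial.induction_on' with
  | add p p' hp hp' => rw [map_add, mul_add, coeff_add, hp, hp', coeff_add, mul_add]
  | monomial t r =>
    have hev : (C A * X i + C B * X j) *
        aeval (Fin.cons (X i + X j) fun k => X (SVskip i j k) :
          Fin (q + 1) → MvPolynomial (Fin (q + 2)) ℂ) (monomial t r) =
        C (r * A) * (X i * ((X i + X j) ^ t 0 * ∏ k, X (SVskip i j k) ^ t k.succ)) +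
        C (r * B) * (X j * ((X i + X j) ^ t 0 * ∏ k, X (SVskip i j k) ^ t k.succ)) := by
      rw [aeval_monomial, Finsupp.prod_fintype _ _ fun _ => pow_zero _, Fin.prod_univ_succ]
      simp only [Fin.cons_zero, Fin.cons_succ, algebraMap_eq, C_mul]
      ring
    have ht : t = Finsupp.equivFunOnFinite.symm
        (Fin.cons (s i + s j - 1) fun k => s (SVskip i j k)) ↔
        s i + s j - 1 = t 0 ∧ (fun k => s (SVskip i j k)) = fun k => t k.succ := by
      rw [Equiv.eq_symm_apply]
      constructor
      · intro hh
        exact ⟨(congrFun hh 0).symm, funext fun k => (congrFun hh k.succ).symm⟩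
      · rintro ⟨h1, h2⟩
        funext k
        refine Fin.cases ?_ (fun k => ?_) k
        · exact h1.symm
        · exact (congrFun h2 k).symm
    rw [hev, coeff_add, coeff_C_mul, coeff_C_mul, coeff_X_mul', coeff_X_mul',
      coeff_add_pow_mul_prod h, coeff_add_pow_mul_prod h, coeff_monomial]
    simp only [ht, Finsupp.mem_support_iff, Finsupp.tsub_apply, Finsupp.single_apply, if_true,
      if_neg h.ne, if_neg h.ne', if_neg (SVskip_ne_left h _).symm,
      if_neg (SVskip_ne_right i j _).symm, tsub_zero]
    generalize (fun k => s (SVskip i j k)) = s'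
    generalize s i = x
    generalize s j = y
    by_cases hs : s' = fun k => t k.succ
    · simp only [hs, and_true]
      exact choose_linear_aux x y (t 0) r A B
    · simp [hs]

lemma SVcoeff_SVd {q : ℕ} (c : SVRaw (q + 1)) (u : Fin (q + 2) → SVBasis) :
    SVcoeff (SVd c) u = 1 / 2 * CEd (SVcoeff c) u := by
  simp only [SVcoeff, SVd, coeff_sum, CEd, Finset.mul_sum]
  refine Finset.sum_congr rfl fun i _ => Finset.sum_congr rfl fun j _ => ?_
  split_ifs with hij
  · have hlin : C (SVbrk (u i).1 (u j).1).2.2 * X i -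
        C (SVbrk (u i).1 (u j).1).2.1 * (X i + X j) =
        C ((SVbrk (u i).1 (u j).1).2.2 - (SVbrk (u i).1 (u j).1).2.1) * X i +
        C (-(SVbrk (u i).1 (u j).1).2.1) * (X j : MvPolynomial (Fin (q + 2)) ℂ) := by
      simp only [C_sub, C_neg]
      ring
    rw [SVdTerm, coeff_smul, hlin, coeff_linear_mul_aeval (Fin.lt_def.mpr hij)]
    have hfst : (fun l => ((Fin.cons (SVbasisBrk (u i) (u j)) fun k => u (SVskip i j k) :
        Fin (q + 1) → SVBasis) l).1) =
        Fin.cons (SVbrk (u i).1 (u j).1).1 fun k => (u (SVskip i j k)).1 := by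
      funext l
      refine Fin.cases ?_ (fun k => ?_) l
      · exact SVbasisBrk_fst _ _
      · rfl
    have hsnd : (fun l => ((Fin.cons (SVbasisBrk (u i) (u j)) fun k => u (SVskip i j k) :
        Fin (q + 1) → SVBasis) l).2) =
        Fin.cons ((u i).2 + (u j).2 - 1) fun k => (u (SVskip i j k)).2 := by
      funext l
      refine Fin.cases ?_ (fun k => ?_) l
      · exact SVbasisBrk_snd _ _
      · rfl
    rw [hfst, hsnd]
    simp only [SVstr, smul_eq_mul]
    push_cast
    rw [SVbrkTwo_fst, SVbrkTwo_snd]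
    by_cases h0 : (u i).2 + (u j).2 = 0
    · rw [if_pos h0, if_pos h0]
      ring
    · rw [if_neg h0, if_neg h0]
      by_cases h1 : (u i).2 = 0
      · rw [if_pos h1]
        ring
      · rw [if_neg h1]
        ring
  · simp

lemma SVstr_L_one (b : SVBasis) : SVstr b (L, 1) = SVwt b := by
  obtain ⟨b, m⟩ := b
  rcases m with _ | m
  · cases b <;> simp [SVstr, SVwt, SVbrkTwo]
  · cases b <;> simp [SVstr, SVwt, SVbrkTwo]

lemma SVbasisBrk_L_one (b : SVBasis) : SVbasisBrk b (L, 1) = b := by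
  obtain ⟨b, m⟩ := b
  cases b <;> rfl

/-- Cartan's formula for the contraction with `L_(1)`. -/
lemma CEd_cons_L_one {q : ℕ} {F : (Fin (q + 2) → SVBasis) → ℂ} (hF : IsAlt F)
    (u : Fin (q + 2) → SVBasis) :
    CEd F (Fin.cons (L, 1) u) =
      (∑ i, SVwt (u i) : ℤ) * F u - CEd (fun w => F (Fin.cons (L, 1) w)) u := by
  have hskip (j : Fin (q + 2)) (k : Fin (q + 1)) :
      SVskip (0 : Fin (q + 3)) j.succ k = (j.succAbove k).succ := by
    rw [SVskip_of_lt (Fin.succ_pos j), Fin.succAbove_zero]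
    rfl
  have hskip0 (i j : Fin (q + 2)) (h : i < j) : SVskip i.succ j.succ (0 : Fin (q + 1)) = 0 := by
    rw [SVskip_of_lt (Fin.succ_lt_succ_iff.mpr h)]
    rw [Fin.lt_def] at h
    ext
    simp only [Fin.succAbove, Fin.lt_def, Fin.val_castSucc, Fin.val_succ]
    split_ifs <;> simp only [Fin.val_castSucc, Fin.val_succ, Fin.val_zero] at * <;> omega
  have hskips (i j : Fin (q + 2)) (h : i < j) (k : Fin q) :
      SVskip i.succ j.succ k.succ = (SVskip i j k).succ := by
    rw [SVskip_of_lt (Fin.succ_lt_succ_iff.mpr h), SVskip_of_lt h]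
    rw [Fin.lt_def] at h
    ext
    simp only [Fin.succAbove, Fin.lt_def, Fin.val_castSucc, Fin.val_succ]
    split_ifs <;> simp only [Fin.val_castSucc, Fin.val_succ] at * <;> omega
  have hswap (x y : SVBasis) (w : Fin q → SVBasis) :
      F (Fin.cons x (Fin.cons y w)) = -F (Fin.cons y (Fin.cons x w)) := by
    have := hF (Equiv.swap 0 1) (Fin.cons y (Fin.cons x w))
    rw [Equiv.Perm.sign_swap (by simp)] at this
    push_cast at this
    rw [neg_one_mul] at this
    rw [← this]
    congr 1
    funext k
    refine Fin.cases ?_ (fun k => ?_) k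
    · simp
    · refine Fin.cases ?_ (fun k => ?_) k
      · simp
      · rw [Function.comp_apply, Equiv.swap_apply_of_ne_of_ne]
        · simp
        · simp
        · simp [Fin.ext_iff]
  unfold CEd
  rw [Fin.sum_univ_succ, Fin.sum_univ_succ, if_neg (lt_irrefl _), zero_add, sub_eq_add_neg]
  congr 1
  · push_cast
    rw [Finset.sum_mul]
    refine Finset.sum_congr rfl fun j _ => ?_
    rw [if_pos (by simp)]
    simp only [Fin.cons_zero, Fin.cons_succ, hskip]
    rw [SVbasisBrk_comm, SVbasisBrk_L_one, hF.cons_succAbove, SVstr_comm, SVstr_L_one]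
    simp only [Fin.val_zero, Fin.val_succ, zero_add, pow_succ]
    have : ((-1 : ℂ) ^ (j : ℕ)) * (-1) ^ (j : ℕ) = 1 := by
      rw [← mul_pow]; simp
    push_cast
    linear_combination (SVwt (u j) : ℂ) * F u * this
  · rw [← Finset.sum_neg_distrib]
    refine Finset.sum_congr rfl fun i _ => ?_
    rw [Fin.sum_univ_succ, if_neg (by simp), zero_add, ← Finset.sum_neg_distrib]
    refine Finset.sum_congr rfl fun j _ => ?_
    simp only [Fin.val_succ, add_lt_add_iff_right, Fin.cons_succ]
    split_ifs with h
    · rw [hswap (L, 1)]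
      have : (fun k : Fin (q + 1) => (Fin.cons (L, 1) u : Fin (q + 3) → SVBasis)
          (SVskip i.succ j.succ k)) = Fin.cons (L, 1) fun k => u (SVskip i j k) := by
        funext k
        refine Fin.cases ?_ (fun k => ?_) k
        · rw [hskip0 i j h]; rfl
        · rw [hskips i j h]; rfl
      rw [this]
      ring
    · simp

lemma CEd_congr_wt {q : ℕ} {F G : (Fin (q + 1) → SVBasis) → ℂ} {u : Fin (q + 2) → SVBasis}
    (h : ∀ w, ∑ i, SVwt (w i) = ∑ i, SVwt (u i) → F w = G w) : CEd F u = CEd G u := by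
  unfold CEd
  refine Finset.sum_congr rfl fun i _ => Finset.sum_congr rfl fun j _ => ?_
  split_ifs with hij
  · by_cases hs : SVstr (u i) (u j) = 0
    · simp [hs]
    · rw [h]
      rw [Fin.sum_univ_succ]
      simp only [Fin.cons_zero, Fin.cons_succ]
      rw [SVwt_brk hs, Fin.sum_univ_succAbove _ i,
        Fin.sum_univ_succAbove _ (⟨j - 1, by omega⟩ : Fin (q + 1)), add_assoc]
      have hj : i.succAbove (⟨j - 1, by omega⟩ : Fin (q + 1)) = j := by
        ext
        simp only [Fin.succAbove, Fin.lt_def, Fin.val_castSucc]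
        split_ifs <;> simp only [Fin.val_castSucc, Fin.val_succ] <;> omega
      simp only [hj, SVskip_of_lt (Fin.lt_def.mpr hij)]
  · rfl

lemma CEd_const_mul {q : ℕ} (r : ℂ) (F : (Fin (q + 1) → SVBasis) → ℂ)
    (u : Fin (q + 2) → SVBasis) : CEd (fun w => r * F w) u = r * CEd F u := by
  simp only [CEd, Finset.mul_sum, mul_ite, mul_zero]
  refine Finset.sum_congr rfl fun i _ => Finset.sum_congr rfl fun j _ => ?_
  split_ifs <;> ring

lemma CEd_add {q : ℕ} (F G : (Fin (q + 1) → SVBasis) → ℂ)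
    (u : Fin (q + 2) → SVBasis) : CEd (fun w => F w + G w) u = CEd F u + CEd G u := by
  simp only [CEd, ← Finset.sum_add_distrib]
  refine Finset.sum_congr rfl fun i _ => Finset.sum_congr rfl fun j _ => ?_
  split_ifs <;> ring

/-- All basis elements that may occur in an injective tuple of weight zero. -/
def SVsmall : Finset SVBasis :=
  {(L, 0), (L, 1), (L, 2), (Y, 0), (Y, 1), (Y, 2), (M, 0), (M, 1)}

lemma subset_SVsmall {T : Finset SVBasis} (hT : ∑ b ∈ T, SVwt b = 0) : T ⊆ SVsmall := by
  have hneg (T' : Finset SVBasis) : -3 ≤ ∑ b ∈ T', SVwt b := by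
    have h1 (b : SVBasis) :
        (if b = (L, 0) then -2 else 0) + (if b = (Y, 0) then -1 else 0) ≤ SVwt b := by
      obtain ⟨b, n⟩ := b
      cases b <;> simp [SVwt] <;> split_ifs <;> omega
    refine le_trans ?_ (Finset.sum_le_sum fun b _ => h1 b)
    rw [Finset.sum_add_distrib, Finset.sum_ite_eq', Finset.sum_ite_eq']
    split_ifs <;> norm_num
  intro b hb
  have h2 := hneg (T.erase b)
  rw [← Finset.add_sum_erase T _ hb] at hT
  have h3 : SVwt b ≤ 3 := by omega
  obtain ⟨b, n⟩ := b
  cases b <;> simp only [SVwt] at h3 <;> simp [SVsmall] <;> omega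

lemma exists_perm_of_image_eq {q : ℕ} {α : Type*} [DecidableEq α] {u v : Fin q → α}
    (hu : u.Injective) (hv : v.Injective)
    (h : Finset.univ.image u = Finset.univ.image v) : ∃ σ : Equiv.Perm (Fin q), u = v ∘ σ := by
  have hr : Set.range u = Set.range v := by
    simpa using congrArg (fun s : Finset α => (s : Set α)) h
  refine ⟨((Equiv.ofInjective u hu).trans (Equiv.setCongr hr)).trans
    (Equiv.ofInjective v hv).symm, ?_⟩
  funext i
  simp [Equiv.apply_ofInjective_symm]

lemma IsAlt.eq_zero_of_image {q : ℕ} {F : (Fin q → SVBasis) → ℂ} (hF : IsAlt F)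
    (hw : ∀ u, ∑ i, SVwt (u i) ≠ 0 → F u = 0) (V : List (Fin q → SVBasis))
    (hV : ∀ T ∈ SVsmall.powersetCard q, ∑ b ∈ T, SVwt b = 0 → ∃ v ∈ V, Finset.univ.image v = T)
    (h : ∀ v ∈ V, F v = 0) (u : Fin q → SVBasis) : F u = 0 := by
  by_cases hu : u.Injective
  · by_cases hs : ∑ i, SVwt (u i) = 0
    · have hcard : (Finset.univ.image u).card = q := by
        rw [Finset.card_image_of_injective _ hu, Finset.card_univ, Fintype.card_fin]
      have hsum : ∑ b ∈ Finset.univ.image u, SVwt b = 0 := by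
        rwa [Finset.sum_image fun _ _ _ _ hxy => hu hxy]
      obtain ⟨v, hvV, hv⟩ := hV _
        (Finset.mem_powersetCard.mpr ⟨subset_SVsmall hsum, hcard⟩) hsum
      have hvi : v.Injective := by
        rw [← Set.injOn_univ, ← Finset.coe_univ, ← Finset.card_image_iff, hv, hcard,
          Finset.card_univ, Fintype.card_fin]
      obtain ⟨σ, rfl⟩ := exists_perm_of_image_eq hu hvi hv.symm
      rw [hF, h v hvV, mul_zero]
    · exact hw u hs
  · rw [Function.not_injective_iff] at hu
    obtain ⟨i, j, hij, hne⟩ := hu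
    exact hF.eq_zero hne hij

/-- A representative of the injective `5`-tuples of weight zero, as are `tupB₁`, `tupB₂`, `tupB₃`
and `tupC`; every such tuple is a permutation of one of them. -/
abbrev tupA : Fin 5 → SVBasis := ![(L, 0), (L, 1), (L, 2), (Y, 0), (Y, 1)]
/-- See `tupA`. -/
abbrev tupB₁ : Fin 5 → SVBasis := ![(L, 0), (L, 1), (Y, 0), (Y, 1), (M, 1)]
/-- See `tupA`. -/
abbrev tupB₂ : Fin 5 → SVBasis := ![(L, 0), (L, 2), (Y, 0), (Y, 1), (M, 0)]
/-- See `tupA`. -/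
abbrev tupB₃ : Fin 5 → SVBasis := ![(L, 0), (L, 1), (Y, 0), (Y, 2), (M, 0)]
/-- See `tupA`. -/
abbrev tupC : Fin 5 → SVBasis := ![(L, 0), (Y, 0), (Y, 1), (M, 0), (M, 1)]

lemma IsAlt.eq_zero_of_five {F : (Fin 5 → SVBasis) → ℂ} (hF : IsAlt F)
    (hw : ∀ u, ∑ i, SVwt (u i) ≠ 0 → F u = 0) (hA : F tupA = 0) (hB₁ : F tupB₁ = 0)
    (hB₂ : F tupB₂ = 0) (hB₃ : F tupB₃ = 0) (hC : F tupC = 0) (u : Fin 5 → SVBasis) :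
    F u = 0 :=
  hF.eq_zero_of_image hw [tupA, tupB₁, tupB₂, tupB₃, tupC] (by decide +kernel)
    (by simp [hA, hB₁, hB₂, hB₃, hC]) u

/-- A representative of the injective `6`-tuples of weight zero, the other one being `tupSix₂`. -/
abbrev tupSix₁ : Fin 6 → SVBasis := ![(L, 0), (L, 1), (L, 2), (Y, 0), (Y, 1), (M, 0)]
/-- See `tupSix₁`. -/
abbrev tupSix₂ : Fin 6 → SVBasis := ![(L, 0), (L, 1), (Y, 0), (Y, 1), (M, 0), (M, 1)]

lemma IsAlt.eq_zero_of_six {F : (Fin 6 → SVBasis) → ℂ} (hF : IsAlt F)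
    (hw : ∀ u, ∑ i, SVwt (u i) ≠ 0 → F u = 0) (h₁ : F tupSix₁ = 0) (h₂ : F tupSix₂ = 0)
    (u : Fin 6 → SVBasis) : F u = 0 :=
  hF.eq_zero_of_image hw [tupSix₁, tupSix₂] (by decide +kernel) (by simp [h₁, h₂]) u

/-- The alternating function dual to the tuple `v`. -/
def dualTuple {q : ℕ} (v u : Fin q → SVBasis) : ℤ :=
  (Matrix.of fun i j => if u i = v j then (1 : ℤ) else 0).det

lemma isAlt_dualTuple {q : ℕ} (v : Fin q → SVBasis) : IsAlt fun u => (dualTuple v u : ℂ) := by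
  intro σ u
  have h := Matrix.det_permute σ (Matrix.of fun i j => if u i = v j then (1 : ℤ) else 0)
  rw [Int.cast_id] at h
  simp only [dualTuple]
  rw [← Int.cast_mul, ← h]
  rfl

lemma exists_perm_of_dualTuple_ne_zero {q : ℕ} {v u : Fin q → SVBasis}
    (h : dualTuple v u ≠ 0) : ∃ σ : Equiv.Perm (Fin q), u = v ∘ σ := by
  rw [dualTuple, Matrix.det_apply] at h
  obtain ⟨σ, -, hσ⟩ := Finset.exists_ne_zero_of_sum_ne_zero h
  have h1 (i : Fin q) : u (σ i) = v i := by
    by_contra hne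
    refine hσ ?_
    rw [Finset.prod_eq_zero (Finset.mem_univ i) (by simp [hne]), smul_zero]
  refine ⟨σ.symm, funext fun i => ?_⟩
  rw [Function.comp_apply, ← h1, Equiv.apply_symm_apply]

lemma dualTuple_eq_zero_of_wt {q : ℕ} {v u : Fin q → SVBasis} (hv : ∑ i, SVwt (v i) = 0)
    (hu : ∑ i, SVwt (u i) ≠ 0) : dualTuple v u = 0 := by
  by_contra hne
  obtain ⟨σ, rfl⟩ := exists_perm_of_dualTuple_ne_zero hne
  exact hu ((Equiv.sum_comp σ fun i => SVwt (v i)).trans hv)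

lemma CEd_intCast {q : ℕ} (F : (Fin (q + 1) → SVBasis) → ℤ) (u : Fin (q + 2) → SVBasis) :
    CEd (fun w => (F w : ℂ)) u = (CEd F u : ℤ) := by
  unfold CEd
  push_cast
  rfl

/-- A `4`-tuple of weight zero of type `(L, L, L, M)`. -/
abbrev tupLLLM : Fin 4 → SVBasis := ![(L, 0), (L, 1), (L, 2), (M, 0)]
/-- A `4`-tuple of weight zero of type `(L, M, Y, Y)`. -/
abbrev tupLMYY : Fin 4 → SVBasis := ![(L, 1), (M, 0), (Y, 0), (Y, 1)]
/-- A `4`-tuple of weight zero of type `(L, L, M, M)`. -/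
abbrev tupLLMM : Fin 4 → SVBasis := ![(L, 0), (L, 1), (M, 0), (M, 1)]

lemma CEd_tupLLLM : CEd (dualTuple tupLLLM) tupA = -2 ∧ CEd (dualTuple tupLLLM) tupB₁ = 0 ∧
    CEd (dualTuple tupLLLM) tupB₂ = 0 ∧ CEd (dualTuple tupLLLM) tupB₃ = 0 := by decide +kernel

lemma CEd_tupLMYY : CEd (dualTuple tupLMYY) tupA = 0 ∧ CEd (dualTuple tupLMYY) tupB₁ = 2 ∧
    CEd (dualTuple tupLMYY) tupB₂ = 2 ∧ CEd (dualTuple tupLMYY) tupB₃ = 2 := by decide +kernel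

lemma CEd_tupLLMM : CEd (dualTuple tupLLMM) tupA = 0 ∧ CEd (dualTuple tupLLMM) tupB₁ = 2 ∧
    CEd (dualTuple tupLLMM) tupB₂ = 0 ∧ CEd (dualTuple tupLLMM) tupB₃ = -2 := by decide +kernel

lemma CEd_dualTuple_tupB₁ :
    CEd (dualTuple tupB₁) tupSix₁ = 0 ∧ CEd (dualTuple tupB₁) tupSix₂ = 0 := by
  decide +kernel

lemma CEd_dualTuple_tupC : CEd (dualTuple tupC) tupSix₁ = 0 ∧ CEd (dualTuple tupC) tupSix₂ = 0 := by
  decide +kernel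

lemma CEd_eq_zero_of_wt {q : ℕ} {F : (Fin (q + 1) → SVBasis) → ℂ}
    (hF : ∀ w, ∑ i, SVwt (w i) ≠ 0 → F w = 0) {u : Fin (q + 2) → SVBasis}
    (hu : ∑ i, SVwt (u i) ≠ 0) : CEd F u = 0 := by
  rw [CEd_congr_wt (G := fun _ => 0) fun w hw => hF w (hw ▸ hu)]
  simp [CEd]

lemma CEd_dualTuple_eq_zero {v : Fin 5 → SVBasis} (hv : ∑ i, SVwt (v i) = 0)
    (h : CEd (dualTuple v) tupSix₁ = 0 ∧ CEd (dualTuple v) tupSix₂ = 0) (u : Fin 6 → SVBasis) :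
    CEd (fun w => (dualTuple v w : ℂ)) u = 0 := by
  refine (isAlt_dualTuple v).CEd.eq_zero_of_six (fun u hu => CEd_eq_zero_of_wt ?_ hu) ?_ ?_ u
  · intro w hw
    rw [dualTuple_eq_zero_of_wt hv hw, Int.cast_zero]
  · rw [CEd_intCast, h.1, Int.cast_zero]
  · rw [CEd_intCast, h.2, Int.cast_zero]

lemma SVwt_eq (b : SVBasis) : SVwt b = SVwt (b.1, 0) + 2 * b.2 := by
  obtain ⟨b, n⟩ := b
  cases b <;> simp [SVwt] <;> ring

lemma SVcoeff_eq_zero_of_wt {q n : ℕ} {c : SVRaw q} (hc : c ∈ SVCochain q) {a : Fin q → SVGen}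
    (ha : (c a).IsHomogeneous n) (hn : ∑ i, SVwt (a i, 0) = -2 * n)
    (h0 : ∀ a', (¬ ∃ σ : Equiv.Perm (Fin q), a' = a ∘ σ) → c a' = 0)
    (u : Fin q → SVBasis) (hu : ∑ i, SVwt (u i) ≠ 0) : SVcoeff c u = 0 := by
  rw [mem_SVCochain_iff] at hc
  by_cases h : ∃ σ : Equiv.Perm (Fin q), (fun i => (u i).1) = a ∘ σ
  · obtain ⟨σ, hσ⟩ := h
    have h1 : u = (u ∘ σ.symm) ∘ σ := by
      funext i
      simp
    have h2 : (fun i => ((u ∘ σ.symm) i).1) = a := by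
      funext i
      have := congrFun hσ (σ.symm i)
      simpa using this
    rw [h1, hc, SVcoeff, h2, ha.coeff_eq_zero, mul_zero]
    intro hd
    rw [Finsupp.degree_eq_sum] at hd
    simp only [Finsupp.equivFunOnFinite_symm_apply_apply, Function.comp_apply] at hd
    rw [Equiv.sum_comp σ.symm fun i => (u i).2] at hd
    refine hu ?_
    have h3 (i : Fin q) : (u i).1 = a (σ i) := congrFun hσ i
    simp only [SVwt_eq (u _), Finset.sum_add_distrib, h3]
    rw [Equiv.sum_comp σ fun i => SVwt (a i, 0), hn, ← Finset.mul_sum, ← hd]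
    push_cast
    ring
  · rw [SVcoeff, h0 _ h, coeff_zero]

lemma SVcoeff_eq_zero_of_gen {q : ℕ} {c : SVRaw q} {a : Fin q → SVGen}
    (h0 : ∀ a', (¬ ∃ σ : Equiv.Perm (Fin q), a' = a ∘ σ) → c a' = 0) {u : Fin q → SVBasis}
    (hu : ¬ ∃ σ : Equiv.Perm (Fin q), (fun i => (u i).1) = a ∘ σ) : SVcoeff c u = 0 := by
  rw [SVcoeff, h0 _ hu, coeff_zero]

lemma coeff_X_mul_X {q : ℕ} (i j : Fin q) (s : Fin q → ℕ) :
    coeff (Finsupp.equivFunOnFinite.symm s) (X i * X j : MvPolynomial (Fin q) ℂ) =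
      if Pi.single i 1 + Pi.single j 1 = s then 1 else 0 := by
  have (i : Fin q) : (X i : MvPolynomial (Fin q) ℂ) =
      monomial (Finsupp.equivFunOnFinite.symm (Pi.single i 1)) 1 := by
    rw [X, ← Finsupp.equivFunOnFinite_single, Equiv.symm_apply_apply]
  rw [this, this, monomial_mul, coeff_monomial, mul_one]
  congr 1
  rw [eq_iff_iff, Equiv.eq_symm_apply]
  rfl

lemma coeff_X_mul_X_mul_X {q : ℕ} (i j k : Fin q) (s : Fin q → ℕ) :
    coeff (Finsupp.equivFunOnFinite.symm s) (X i * X j * X k : MvPolynomial (Fin q) ℂ) =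
      if Pi.single i 1 + Pi.single j 1 + Pi.single k 1 = s then 1 else 0 := by
  have (i : Fin q) : (X i : MvPolynomial (Fin q) ℂ) =
      monomial (Finsupp.equivFunOnFinite.symm (Pi.single i 1)) 1 := by
    rw [X, ← Finsupp.equivFunOnFinite_single, Equiv.symm_apply_apply]
  rw [this, this, this, monomial_mul, monomial_mul, coeff_monomial, mul_one, mul_one]
  congr 1
  rw [eq_iff_iff, Equiv.eq_symm_apply]
  rfl

lemma SVcoeff_eq_dualTuple {c : SVRaw 5} (hc : c ∈ SVCochain 5)
    (hw : ∀ u, ∑ i, SVwt (u i) ≠ 0 → SVcoeff c u = 0) {v : Fin 5 → SVBasis}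
    (hv : ∑ i, SVwt (v i) = 0) (hA : SVcoeff c tupA = dualTuple v tupA)
    (hB₁ : SVcoeff c tupB₁ = dualTuple v tupB₁) (hB₂ : SVcoeff c tupB₂ = dualTuple v tupB₂)
    (hB₃ : SVcoeff c tupB₃ = dualTuple v tupB₃) (hC : SVcoeff c tupC = dualTuple v tupC) :
    SVcoeff c = fun u => (dualTuple v u : ℂ) := by
  funext u
  rw [← sub_eq_zero]
  have hF : IsAlt fun u => SVcoeff c u - (dualTuple v u : ℂ) := by
    intro σ u
    have h1 := isAlt_dualTuple v σ u
    rw [mem_SVCochain_iff] at hc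
    linear_combination hc σ u - h1
  refine hF.eq_zero_of_five (fun u hu => ?_) (sub_eq_zero.mpr hA) (sub_eq_zero.mpr hB₁)
    (sub_eq_zero.mpr hB₂) (sub_eq_zero.mpr hB₃) (sub_eq_zero.mpr hC) u
  simp only [hw u hu, dualTuple_eq_zero_of_wt hv hu, Int.cast_zero, sub_zero]

lemma SVcoeff_LLYYM {c : SVRaw 5} (hc : c ∈ SVCochain 5)
    (hv : c ![L, L, Y, Y, M] = (X 0 - X 1) * (X 2 - X 3) * X 4)
    (h0 : ∀ a : Fin 5 → SVGen,
      (¬ ∃ σ : Equiv.Perm (Fin 5), a = ![L, L, Y, Y, M] ∘ σ) → c a = 0) :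
    SVcoeff c = fun u => (dualTuple tupB₁ u : ℂ) := by
  have hh : (c ![L, L, Y, Y, M]).IsHomogeneous 3 := by
    rw [hv]
    have hX (i : Fin 5) := isHomogeneous_X ℂ i
    exact (((hX 0).sub (hX 1)).mul ((hX 2).sub (hX 3))).mul (hX 4)
  have hval (u : Fin 5 → SVBasis) (hu : (fun i => (u i).1) = ![L, L, Y, Y, M]) :
      SVcoeff c u = (((if Pi.single 0 1 + Pi.single 2 1 + Pi.single 4 1 = fun i => (u i).2
        then 1 else 0) - (if Pi.single 0 1 + Pi.single 3 1 + Pi.single 4 1 = fun i => (u i).2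
        then 1 else 0) - (if Pi.single 1 1 + Pi.single 2 1 + Pi.single 4 1 = fun i => (u i).2
        then 1 else 0) + (if Pi.single 1 1 + Pi.single 3 1 + Pi.single 4 1 = fun i => (u i).2
        then 1 else 0) : ℤ) : ℂ) := by
    rw [SVcoeff, hu, hv]
    push_cast
    simp only [← coeff_X_mul_X_mul_X, ← coeff_sub, ← coeff_add]
    congr 1
    ring
  refine SVcoeff_eq_dualTuple hc (SVcoeff_eq_zero_of_wt hc hh (by decide) h0) (by decide)
    ?_ ?_ ?_ ?_ ?_
  · rw [SVcoeff_eq_zero_of_gen h0 (by decide +kernel), eq_comm, Int.cast_eq_zero]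
    decide +kernel
  · rw [hval _ (by decide)]
    exact congrArg _ (by decide +kernel)
  · rw [hval _ (by decide)]
    exact congrArg _ (by decide +kernel)
  · rw [hval _ (by decide)]
    exact congrArg _ (by decide +kernel)
  · rw [SVcoeff_eq_zero_of_gen h0 (by decide +kernel), eq_comm, Int.cast_eq_zero]
    decide +kernel

lemma SVcoeff_LYYMM {c : SVRaw 5} (hc : c ∈ SVCochain 5)
    (hv : c ![L, Y, Y, M, M] = (X 1 - X 2) * (X 3 - X 4))
    (h0 : ∀ a : Fin 5 → SVGen,
      (¬ ∃ σ : Equiv.Perm (Fin 5), a = ![L, Y, Y, M, M] ∘ σ) → c a = 0) :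
    SVcoeff c = fun u => (dualTuple tupC u : ℂ) := by
  have hh : (c ![L, Y, Y, M, M]).IsHomogeneous 2 := by
    rw [hv]
    have hX (i : Fin 5) := isHomogeneous_X ℂ i
    exact ((hX 1).sub (hX 2)).mul ((hX 3).sub (hX 4))
  refine SVcoeff_eq_dualTuple hc (SVcoeff_eq_zero_of_wt hc hh (by decide) h0) (by decide)
    ?_ ?_ ?_ ?_ ?_
  iterate 4
    rw [SVcoeff_eq_zero_of_gen h0 (by decide +kernel), eq_comm, Int.cast_eq_zero]
    decide +kernel
  have hgen : (fun i => (tupC i).1) = ![L, Y, Y, M, M] := by decide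
  have hexp : (X 1 - X 2) * (X 3 - X 4) =
      X 1 * X 3 - X 1 * X 4 - X 2 * X 3 + (X 2 * X 4 : MvPolynomial (Fin 5) ℂ) := by ring
  rw [SVcoeff, hgen, hv, hexp, coeff_add, coeff_sub, coeff_sub, coeff_X_mul_X, coeff_X_mul_X,
    coeff_X_mul_X, coeff_X_mul_X, if_neg (by decide), if_neg (by decide), if_neg (by decide),
    if_pos (by decide), show dualTuple tupC tupC = 1 by decide +kernel]
  norm_num

lemma CEd_sum {q : ℕ} {ι : Type*} (s : Finset ι) (F : ι → (Fin (q + 1) → SVBasis) → ℂ)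
    (u : Fin (q + 2) → SVBasis) : CEd (fun w => ∑ k ∈ s, F k w) u = ∑ k ∈ s, CEd (F k) u := by
  induction s using Finset.cons_induction with
  | empty => simp [CEd]
  | cons a s ha ih => simp only [Finset.sum_cons, ← ih, CEd_add]

lemma CEd_eq_sum_dualTuple {q n : ℕ} {G : (Fin (q + 1) → SVBasis) → ℂ} (hG : IsAlt G)
    (t : Fin n → Fin (q + 1) → SVBasis)
    (htt : ∀ k l, dualTuple (t k) (t l) = if k = l then 1 else 0)
    (hV : ∀ T ∈ SVsmall.powersetCard (q + 1), ∑ b ∈ T, SVwt b = 0 →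
      ∃ v ∈ List.ofFn t, Finset.univ.image v = T)
    {u : Fin (q + 2) → SVBasis} (hu : ∑ i, SVwt (u i) = 0) :
    CEd G u = ∑ k, G (t k) * (CEd (dualTuple (t k)) u : ℤ) := by
  have hsum (w : Fin (q + 1) → SVBasis) (hw : ∑ i, SVwt (w i) = 0) :
      G w = ∑ k, G (t k) * (dualTuple (t k) w : ℂ) := by
    let G' : (Fin (q + 1) → SVBasis) → ℂ := fun w =>
      if ∑ i, SVwt (w i) = 0 then G w - ∑ k, G (t k) * (dualTuple (t k) w : ℂ) else 0
    have hG' : IsAlt G' := by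
      intro σ w
      have h1 : ∑ i, SVwt ((w ∘ σ) i) = ∑ i, SVwt (w i) :=
        Equiv.sum_comp σ fun i => SVwt (w i)
      simp only [G', h1]
      split_ifs
      · rw [hG, mul_sub, Finset.mul_sum]
        congr 1
        refine Finset.sum_congr rfl fun k _ => ?_
        have h2 := isAlt_dualTuple (t k) σ w
        simp only at h2
        rw [h2]
        ring
      · simp
    have h := hG'.eq_zero_of_image (fun w hw => if_neg hw) _ hV ?_ w
    · simp only [G', if_pos hw] at h
      exact sub_eq_zero.mp h
    · intro v hv
      obtain ⟨l, rfl⟩ := (List.mem_ofFn' t v).mp hv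
      simp [G', htt]
  rw [CEd_congr_wt (G := fun w => ∑ k, G (t k) * (dualTuple (t k) w : ℂ))
    fun w hw => hsum w (hw.trans hu)]
  have h2 (k : Fin n) : G (t k) * (CEd (dualTuple (t k)) u : ℤ) =
      CEd (fun w => G (t k) * (dualTuple (t k) w : ℂ)) u := by
    rw [CEd_const_mul, CEd_intCast]
  simp only [h2]
  exact CEd_sum _ _ _

/-- Representatives of the injective `4`-tuples of weight zero. -/
def tupFour : Fin 7 → Fin 4 → SVBasis :=
  ![![(L, 0), (L, 1), (L, 2), (M, 0)], ![(L, 0), (L, 1), (Y, 0), (Y, 2)],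
    ![(L, 0), (L, 1), (M, 0), (M, 1)], ![(L, 0), (L, 2), (Y, 0), (Y, 1)],
    ![(L, 0), (Y, 0), (Y, 1), (M, 1)], ![(L, 0), (Y, 0), (Y, 2), (M, 0)],
    ![(L, 1), (Y, 0), (Y, 1), (M, 0)]]

lemma CEd_eq_sum_tupFour {G : (Fin 4 → SVBasis) → ℂ} (hG : IsAlt G) {u : Fin 5 → SVBasis}
    (hu : ∑ i, SVwt (u i) = 0) :
    CEd G u = ∑ k, G (tupFour k) * (CEd (dualTuple (tupFour k)) u : ℤ) :=
  CEd_eq_sum_dualTuple hG tupFour (by decide +kernel) (by decide +kernel) hu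

lemma CEd_tupC {G : (Fin 4 → SVBasis) → ℂ} (hG : IsAlt G) : CEd G tupC = 0 := by
  have h : ∀ k, CEd (dualTuple (tupFour k)) tupC = 0 := by decide +kernel
  rw [CEd_eq_sum_tupFour hG (by decide)]
  simp [h]

lemma CEd_tupB {G : (Fin 4 → SVBasis) → ℂ} (hG : IsAlt G) :
    CEd G tupB₁ - 2 * CEd G tupB₂ + CEd G tupB₃ = 0 := by
  have h : ∀ k, CEd (dualTuple (tupFour k)) tupB₁ - 2 * CEd (dualTuple (tupFour k)) tupB₂ +
      CEd (dualTuple (tupFour k)) tupB₃ = 0 := by decide +kernel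
  rw [CEd_eq_sum_tupFour hG (by decide), CEd_eq_sum_tupFour hG (by decide),
    CEd_eq_sum_tupFour hG (by decide), Finset.mul_sum, ← Finset.sum_sub_distrib,
    ← Finset.sum_add_distrib]
  refine Finset.sum_eq_zero fun k _ => ?_
  have hk := congrArg (Int.cast : ℤ → ℂ) (h k)
  push_cast at hk
  linear_combination G (tupFour k) * hk

lemma dualTuple_eq_zero_of_lt {q B : ℕ} {v u : Fin q → SVBasis} (hv : ∀ j, (v j).2 ≤ B)
    {i : Fin q} (hu : B < (u i).2) : dualTuple v u = 0 := by
  by_contra hne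
  obtain ⟨σ, rfl⟩ := exists_perm_of_dualTuple_ne_zero hne
  exact absurd (hv (σ i)) (not_le.mpr hu)

lemma isAlt_wt_inv_mul {q : ℕ} {G : (Fin q → SVBasis) → ℂ} (hG : IsAlt G) :
    IsAlt fun w => ((∑ i, SVwt (w i) : ℤ) : ℂ)⁻¹ * G w := by
  intro σ w
  have h1 : ∑ i, SVwt ((w ∘ σ) i) = ∑ i, SVwt (w i) := Equiv.sum_comp σ fun i => SVwt (w i)
  simp only [h1, hG σ w]
  ring

lemma exists_primitive {F : (Fin 5 → SVBasis) → ℂ} (hF : IsAlt F) (hd : ∀ u, CEd F u = 0)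
    (hB : ∃ B : ℕ, ∀ u, F u ≠ 0 → ∀ i, (u i).2 ≤ B) :
    ∃ β ∈ SVCochain 4, ∀ u, SVcoeff (SVd β) u =
      F u - ((F tupB₁ - 2 * F tupB₂ + F tupB₃) * dualTuple tupB₁ u +
        F tupC * dualTuple tupC u) := by
  obtain ⟨B, hB⟩ := hB
  let k : (Fin 4 → SVBasis) → ℂ := fun w =>
    ((∑ i, SVwt (w i) : ℤ) : ℂ)⁻¹ * F (Fin.cons (L, 1) w)
  let a₁ : ℂ := -F tupA / 2
  let a₂ : ℂ := F tupB₂ / 2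
  let a₃ : ℂ := (F tupB₂ - F tupB₃) / 2
  let h : (Fin 4 → SVBasis) → ℂ := fun w => 2 * (k w + (a₁ * dualTuple tupLLLM w +
    (a₂ * dualTuple tupLMYY w + a₃ * dualTuple tupLLMM w)))
  have hk : IsAlt k := isAlt_wt_inv_mul (hF.cons _)
  have hh : IsAlt h := by
    intro σ w
    have h1 := isAlt_dualTuple tupLLLM σ w
    have h2 := isAlt_dualTuple tupLMYY σ w
    have h3 := isAlt_dualTuple tupLLMM σ w
    simp only [h, hk σ w, h1, h2, h3]
    ring
  have hCEd (u : Fin 5 → SVBasis) : 1 / 2 * CEd h u = CEd k u +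
      (a₁ * (CEd (dualTuple tupLLLM) u : ℤ) + (a₂ * (CEd (dualTuple tupLMYY) u : ℤ) +
        a₃ * (CEd (dualTuple tupLLMM) u : ℤ))) := by
    simp only [h, CEd_const_mul, CEd_add, CEd_intCast]
    ring
  obtain ⟨β, hβ⟩ := exists_SVcoeff_eq h (B + 2) fun w hw i => by
    by_contra! hlt
    refine hw ?_
    have h1 : F (Fin.cons (L, 1) w) = 0 := by
      by_contra hne
      have := hB _ hne i.succ
      rw [Fin.cons_succ] at this
      omega
    have h2 (v : Fin 4 → SVBasis) (hv : ∀ j, (v j).2 ≤ 2) : dualTuple v w = 0 :=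
      dualTuple_eq_zero_of_lt (i := i) hv (by omega)
    simp only [h, k, h1, h2 tupLLLM (by decide), h2 tupLMYY (by decide),
      h2 tupLLMM (by decide)]
    simp
  refine ⟨β, by rw [mem_SVCochain_iff, hβ]; exact hh, fun u => ?_⟩
  rw [SVcoeff_SVd, hβ, eq_comm, ← sub_eq_zero]
  have hG : IsAlt fun u => F u - ((F tupB₁ - 2 * F tupB₂ + F tupB₃) * dualTuple tupB₁ u +
      F tupC * dualTuple tupC u) - 1 / 2 * CEd h u := by
    intro σ u
    have h1 := isAlt_dualTuple tupB₁ σ u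
    have h2 := isAlt_dualTuple tupC σ u
    simp only [hF σ u, h1, h2, hh.CEd σ u]
    ring
  have hk0 {u : Fin 5 → SVBasis} (hu : ∑ i, SVwt (u i) = 0) : CEd k u = 0 := by
    rw [CEd_congr_wt (G := fun _ => 0) fun w hw => by
      simp only [k, hw, hu, Int.cast_zero, inv_zero, zero_mul]]
    simp [CEd]
  refine hG.eq_zero_of_five (fun u hu => ?_) ?_ ?_ ?_ ?_ ?_ u
  · have hu' : ((∑ i, SVwt (u i) : ℤ) : ℂ) ≠ 0 := by exact_mod_cast hu
    have h1 : CEd k u = F u := by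
      rw [CEd_congr_wt (G := fun w => ((∑ i, SVwt (u i) : ℤ) : ℂ)⁻¹ * F (Fin.cons (L, 1) w))
        fun w hw => by simp only [k, hw], CEd_const_mul, inv_mul_eq_iff_eq_mul₀ hu']
      have := CEd_cons_L_one hF u
      rw [hd] at this
      linear_combination this
    have h2 (v : Fin 4 → SVBasis) (hv : ∑ i, SVwt (v i) = 0) : CEd (dualTuple v) u = 0 := by
      have := CEd_eq_zero_of_wt (F := fun w => (dualTuple v w : ℂ))
        (fun w hw => by simp [dualTuple_eq_zero_of_wt hv hw]) hu
      simpa [CEd_intCast] using this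
    simp only [hCEd, h1, h2 tupLLLM (by decide), h2 tupLMYY (by decide),
      h2 tupLLMM (by decide), dualTuple_eq_zero_of_wt (v := tupB₁) (by decide) hu,
      dualTuple_eq_zero_of_wt (v := tupC) (by decide) hu]
    simp
  · have h1 : dualTuple tupB₁ tupA = 0 ∧ dualTuple tupC tupA = 0 := by decide +kernel
    simp only [hCEd, hk0 (u := tupA) (by decide), h1, CEd_tupLLLM, CEd_tupLMYY, CEd_tupLLMM, a₁]
    push_cast
    ring
  · have h1 : dualTuple tupB₁ tupB₁ = 1 ∧ dualTuple tupC tupB₁ = 0 := by decide +kernel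
    simp only [hCEd, hk0 (u := tupB₁) (by decide), h1, CEd_tupLLLM, CEd_tupLMYY, CEd_tupLLMM,
      a₂, a₃]
    push_cast
    ring
  · have h1 : dualTuple tupB₁ tupB₂ = 0 ∧ dualTuple tupC tupB₂ = 0 := by decide +kernel
    simp only [hCEd, hk0 (u := tupB₂) (by decide), h1, CEd_tupLLLM, CEd_tupLMYY, CEd_tupLLMM,
      a₂, a₃]
    push_cast
    ring
  · have h1 : dualTuple tupB₁ tupB₃ = 0 ∧ dualTuple tupC tupB₃ = 0 := by decide +kernel
    simp only [hCEd, hk0 (u := tupB₃) (by decide), h1, CEd_tupLLLM, CEd_tupLMYY, CEd_tupLLMM,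
      a₂, a₃]
    push_cast
    ring
  · have h1 : dualTuple tupB₁ tupC = 0 ∧ dualTuple tupC tupC = 1 := by decide +kernel
    simp only [CEd_tupC hh, h1]
    push_cast
    ring

lemma finrank_quotient_eq_two {K V : Type*} [Field K] [AddCommGroup V] [Module K V]
    (p : Submodule K V) (x y : V) (hli : ∀ a b : K, a • x + b • y ∈ p → a = 0 ∧ b = 0)
    (hsp : ∀ v, ∃ a b : K, v - (a • x + b • y) ∈ p) : Module.finrank K (V ⧸ p) = 2 := by
  have h1 : LinearIndependent K ![p.mkQ x, p.mkQ y] := by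
    rw [LinearIndependent.pair_iff]
    intro a b h
    rw [← map_smul, ← map_smul, ← map_add] at h
    exact hli a b ((Submodule.Quotient.mk_eq_zero p).mp h)
  have h2 : ⊤ ≤ Submodule.span K (Set.range ![p.mkQ x, p.mkQ y]) := by
    rintro v -
    obtain ⟨v, rfl⟩ := p.mkQ_surjective v
    obtain ⟨a, b, h⟩ := hsp v
    rw [Matrix.range_cons_cons_empty, Submodule.mem_span_pair]
    refine ⟨a, b, ?_⟩
    rw [← map_smul, ← map_smul, ← map_add, eq_comm]
    exact (Submodule.Quotient.eq p).mpr h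
  rw [Module.finrank_eq_card_basis (Module.Basis.mk h1 h2), Fintype.card_fin]

lemma SVcoeff_add {q : ℕ} (c c' : SVRaw q) (u : Fin q → SVBasis) :
    SVcoeff (c + c') u = SVcoeff c u + SVcoeff c' u :=
  coeff_add _ _ _

lemma SVcoeff_sub {q : ℕ} (c c' : SVRaw q) (u : Fin q → SVBasis) :
    SVcoeff (c - c') u = SVcoeff c u - SVcoeff c' u :=
  coeff_sub _ _ _ _

lemma SVcoeff_smul {q : ℕ} (r : ℂ) (c : SVRaw q) (u : Fin q → SVBasis) :
    SVcoeff (r • c) u = r * SVcoeff c u :=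
  coeff_smul _ _ _

lemma mem_SVcocycles_of_dualTuple {c : SVRaw 5} (hc : c ∈ SVCochain 5) {v : Fin 5 → SVBasis}
    (hcv : SVcoeff c = fun u => (dualTuple v u : ℂ)) (hv : ∑ i, SVwt (v i) = 0)
    (h : CEd (dualTuple v) tupSix₁ = 0 ∧ CEd (dualTuple v) tupSix₂ = 0) : c ∈ SVcocycles 5 := by
  refine Submodule.mem_inf.mpr ⟨hc, SVRaw_ext fun u => ?_⟩
  change SVcoeff (SVd c) u = _
  rw [SVcoeff_SVd, hcv, CEd_dualTuple_eq_zero hv h, mul_zero]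
  exact (coeff_zero _).symm

open SVGen in
/-- `H̃⁵(SV,ℂ) = ℂΛ ⊕ ℂΨ` is two-dimensional, where `Λ` is the
`5`-cochain with `Λ_{λ₁,…,λ₅}(L,L,Y,Y,M) = (λ₁-λ₂)(λ₃-λ₄)λ₅`, `Ψ` is the
`5`-cochain with `Ψ_{λ₁,…,λ₅}(L,Y,Y,M,M) = (λ₂-λ₃)(λ₄-λ₅)`, each vanishing on
all tuples of generators which are not (a permutation of) the displayed one:
`Λ` and `Ψ` are `5`-cocycles, no nontrivial linear combination of them is a
`5`-coboundary, and modulo coboundaries they span the `5`-cocycles. -/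
theorem statement9 (Λ Ψ : SVRaw 5)
    (hΛc : Λ ∈ SVCochain 5)
    (hΛv : Λ ![L, L, Y, Y, M] = (X 0 - X 1) * (X 2 - X 3) * X 4)
    (hΛ0 : ∀ a : Fin 5 → SVGen,
      (¬ ∃ σ : Equiv.Perm (Fin 5), a = ![L, L, Y, Y, M] ∘ σ) → Λ a = 0)
    (hΨc : Ψ ∈ SVCochain 5)
    (hΨv : Ψ ![L, Y, Y, M, M] = (X 1 - X 2) * (X 3 - X 4))
    (hΨ0 : ∀ a : Fin 5 → SVGen,
      (¬ ∃ σ : Equiv.Perm (Fin 5), a = ![L, Y, Y, M, M] ∘ σ) → Ψ a = 0) :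
    Λ ∈ SVcocycles 5 ∧ Ψ ∈ SVcocycles 5 ∧
    (∀ c₁ c₂ : ℂ, c₁ • Λ + c₂ • Ψ ∈ SVcoboundaries 5 → c₁ = 0 ∧ c₂ = 0) ∧
    (∀ γ : SVRaw 5, γ ∈ SVcocycles 5 →
      ∃ c₁ c₂ : ℂ, γ - (c₁ • Λ + c₂ • Ψ) ∈ SVcoboundaries 5) ∧
    Module.finrank ℂ (SVbasicH 5) = 2 := by
  have hΛ := SVcoeff_LLYYM hΛc hΛv hΛ0
  have hΨ := SVcoeff_LYYMM hΨc hΨv hΨ0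
  have hΛz : Λ ∈ SVcocycles 5 :=
    mem_SVcocycles_of_dualTuple hΛc hΛ (by decide) CEd_dualTuple_tupB₁
  have hΨz : Ψ ∈ SVcocycles 5 :=
    mem_SVcocycles_of_dualTuple hΨc hΨ (by decide) CEd_dualTuple_tupC
  have hli : ∀ c₁ c₂ : ℂ, c₁ • Λ + c₂ • Ψ ∈ SVcoboundaries 5 → c₁ = 0 ∧ c₂ = 0 := by
    rintro c₁ c₂ ⟨β, hβ, hβd⟩
    rw [SetLike.mem_coe, mem_SVCochain_iff] at hβ
    have h (u : Fin 5 → SVBasis) :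
        1 / 2 * CEd (SVcoeff β) u = c₁ * dualTuple tupB₁ u + c₂ * dualTuple tupC u := by
      rw [← SVcoeff_SVd, show SVd β = c₁ • Λ + c₂ • Ψ from hβd, SVcoeff_add, SVcoeff_smul,
        SVcoeff_smul, hΛ, hΨ]
    have hB₁ := h tupB₁
    have hB₂ := h tupB₂
    have hB₃ := h tupB₃
    have hC := h tupC
    have h1 : dualTuple tupB₁ tupB₁ = 1 ∧ dualTuple tupB₁ tupB₂ = 0 ∧
        dualTuple tupB₁ tupB₃ = 0 ∧ dualTuple tupB₁ tupC = 0 ∧ dualTuple tupC tupB₁ = 0 ∧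
        dualTuple tupC tupB₂ = 0 ∧ dualTuple tupC tupB₃ = 0 ∧ dualTuple tupC tupC = 1 := by
      decide +kernel
    simp only [h1, Int.cast_zero, Int.cast_one, CEd_tupC hβ] at hB₁ hB₂ hB₃ hC
    constructor
    · linear_combination -hB₁ + 2 * hB₂ - hB₃ + CEd_tupB hβ / 2
    · linear_combination -hC
  have hsp : ∀ γ : SVRaw 5, γ ∈ SVcocycles 5 →
      ∃ c₁ c₂ : ℂ, γ - (c₁ • Λ + c₂ • Ψ) ∈ SVcoboundaries 5 := by
    rintro γ ⟨hγ, hγd⟩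
    have hd (u : Fin 6 → SVBasis) : CEd (SVcoeff γ) u = 0 := by
      have h := SVcoeff_SVd γ u
      rw [show SVd γ = 0 from hγd, show SVcoeff (0 : SVRaw 6) u = 0 from coeff_zero _] at h
      linear_combination -2 * h
    obtain ⟨β, hβ, h⟩ := exists_primitive ((mem_SVCochain_iff γ).mp hγ) hd (SVcoeff_bounded γ)
    refine ⟨SVcoeff γ tupB₁ - 2 * SVcoeff γ tupB₂ + SVcoeff γ tupB₃, SVcoeff γ tupC, β, hβ,
      SVRaw_ext fun u => (h u).trans ?_⟩
    rw [SVcoeff_sub, SVcoeff_add, SVcoeff_smul, SVcoeff_smul, hΛ, hΨ]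
  refine ⟨hΛz, hΨz, hli, hsp, ?_⟩
  exact finrank_quotient_eq_two (Submodule.comap (SVcocycles 5).subtype (SVcoboundaries 5))
    ⟨Λ, hΛz⟩ ⟨Ψ, hΨz⟩ hli fun γ => hsp γ γ.2

end SVCA
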